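/- arXiv:1408.6487 — 2 statements merged into one kernel-verified Lean document; each statement's English description precedes it below -/
import Mathlib

section
/- If X ⊆ {0,1}^ℤ is a minimal subshift defined by a computably enumerable set of forbidden words (an effective minimal subshift), then X contains a computable point. -/
/-- The shift map on biinfinite sequences: `(shift x) n = x (n+1)`. -/
def shift {A : Type*} (x : ℤ → A) : ℤ → A := fun n => x (n + 1)

/-- Shift by an arbitrary integer amount. -/
def shiftZ {A : Type*} (n : ℤ) (x : ℤ → A) : ℤ → A := fun m => x (m + n)

/-- A finite word `w` appears in `x` (at some position). -/
def Appears {A : Type*} (w : List A) (x : ℤ → A) : Prop :=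
  ∃ k : ℤ, ∀ i : ℕ, ∀ h : i < w.length, x (k + (i : ℤ)) = w[i]

/-- The shift orbit of a point. -/
def orbit {A : Type*} (x : ℤ → A) : Set (ℤ → A) := Set.range fun n : ℤ => shiftZ n x

/-- A (nonempty closed shift-invariant) set `X` is minimal if its only
nonempty closed shift-invariant subset is `X` itself. -/
def IsMinimalOn {A : Type*} [TopologicalSpace A] (X : Set (ℤ → A)) : Prop :=
  ∀ Y ⊆ X, IsClosed Y → shift '' Y = Y → Y.Nonempty → Y = X

/-- The subshift defined by a set `F` of forbidden finite words. -/
def XF {A : Type*} (F : Set (List A)) : Set (ℤ → A) :=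
  {x | ∀ w ∈ F, ¬ Appears w x}

/-- The length-`k` prefix of an infinite binary sequence, as a list. -/
def oPrefix (x : ℕ → Bool) (k : ℕ) : List Bool := (List.range k).map x

/-- Monotonicity (consistency) of a finite-oracle-use approximation map:
answers given on an oracle prefix persist on longer prefixes. -/
def Monot (f : List Bool → ℕ → Option Bool) : Prop :=
  ∀ l l' n b, l <+: l' → f l n = some b → f l' n = some b

/-- The functional coded by `f`, run with oracle `x`, is total with output `y`. -/
def Outputs (f : List Bool → ℕ → Option Bool) (x y : ℕ → Bool) : Prop :=
  ∀ n, ∃ k, f (oPrefix x k) n = some (y n)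

/-- `f` codes a (partial) Turing functional `{0,1}^ℕ ⇀ {0,1}^ℕ`:
a computable, prefix-monotone approximation map. -/
def IsFunctional (f : List Bool → ℕ → Option Bool) : Prop :=
  Computable₂ f ∧ Monot f

/-- Turing reducibility: `y ≤_T x` iff some Turing functional maps oracle `x` to `y`. -/
def TuringLE (y x : ℕ → Bool) : Prop :=
  ∃ f, IsFunctional f ∧ Outputs f x y

/-- Turing equivalence. -/
def TuringEquiv (x y : ℕ → Bool) : Prop := TuringLE x y ∧ TuringLE y x

/-- View a biinfinite binary sequence as an element of Cantor space via a
computable bijection `ℕ ≃ ℤ`. -/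
def toSeq (x : ℤ → Bool) : ℕ → Bool := fun n => x (Denumerable.ofNat ℤ n)

/-- Prepend a finite word to an infinite sequence. -/
def catS (w : List Bool) (x : ℕ → Bool) : ℕ → Bool :=
  fun n => if h : n < w.length then w[n] else x (n - w.length)

/-- A set of words is computably enumerable. -/
def IsCE (F : Set (List Bool)) : Prop :=
  ∃ g : ℕ → Option (List Bool), Computable g ∧ F = {w | ∃ n, g n = some w}

/-- all binary words of length `n` -/
def allw (n : ℕ) : List (List Bool) :=
  Nat.rec [[]] (fun _ l => l.map (List.cons false) ++ l.map (List.cons true)) n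

lemma mem_allw (n : ℕ) (u : List Bool) : u ∈ allw n ↔ u.length = n := by
  induction n generalizing u with
  | zero => simp [allw]
  | succ n ih =>
    have : allw (n+1) = (allw n).map (List.cons false) ++ (allw n).map (List.cons true) := rfl
    rw [this]
    cases u with
    | nil => simp
    | cons a u => cases a <;> simp [ih]

lemma primrec_allw : Primrec allw := by
  refine Primrec.nat_rec₁ (f := fun _ (l : List (List Bool)) => l.map (List.cons false) ++ l.map (List.cons true)) _ ?_
  exact Primrec.list_append.comp
    (Primrec.list_map Primrec.snd (Primrec.list_cons.comp (Primrec.const false) Primrec.snd).to₂)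
    (Primrec.list_map Primrec.snd (Primrec.list_cons.comp (Primrec.const true) Primrec.snd).to₂)

/-- `v` occurs in the finite word `u` -/
def Occ (v u : List Bool) : Prop :=
  ∃ i < u.length + 1, ∀ j < v.length, u[i+j]? = v[j]?

/-- every word of length `n` contains a word from `vs` -/
def Unav (n : ℕ) (vs : List (List Bool)) : Prop := ∀ u ∈ allw n, ∃ v ∈ vs, Occ v u

lemma primrec_occ : PrimrecRel Occ := by
  have h1 : PrimrecRel (fun (j : ℕ) (p : ℕ × List Bool × List Bool) =>
      p.2.2[p.1+j]? = p.2.1[j]?) := by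
    refine Primrec.eq.comp (Primrec.list_getElem?.comp ?_ ?_) (Primrec.list_getElem?.comp ?_ ?_)
    · exact Primrec.snd.comp (Primrec.snd.comp Primrec.snd)
    · exact Primrec.nat_add.comp (Primrec.fst.comp Primrec.snd) Primrec.fst
    · exact Primrec.fst.comp (Primrec.snd.comp Primrec.snd)
    · exact Primrec.fst
  have h2 : PrimrecRel (fun (i : ℕ) (p : List Bool × List Bool) =>
      ∀ j < p.1.length, p.2[i+j]? = p.1[j]?) := by
    have h3 := h1.forall_mem_list
    exact (PrimrecPred.comp h3 (Primrec.pair (Primrec.list_range.comp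
      (Primrec.list_length.comp (Primrec.fst.comp Primrec.snd))) Primrec.id)).of_eq (by simp)
  have h4 := h2.exists_mem_list
  exact (PrimrecPred.comp h4 (Primrec.pair (Primrec.list_range.comp
    (Primrec.succ.comp (Primrec.list_length.comp Primrec.snd))) Primrec.id)).of_eq
    (by simp [Occ])

lemma primrec_unav : PrimrecRel Unav := by
  have h1 := primrec_occ.exists_mem_list
  have h2 : PrimrecRel (fun (u : List Bool) (vs : List (List Bool)) => ∃ v ∈ vs, Occ v u) :=
    h1.comp Primrec.snd Primrec.fst
  exact h2.forall_mem_list.comp (primrec_allw.comp Primrec.fst) Primrec.snd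

/-- the first `n` enumerated words -/
def Gl (g : ℕ → Option (List Bool)) (n : ℕ) : List (List Bool) :=
  Nat.rec [] (fun k l => l ++ (g k).toList) n

lemma mem_Gl (g : ℕ → Option (List Bool)) (n : ℕ) (v : List Bool) :
    v ∈ Gl g n ↔ ∃ k < n, g k = some v := by
  induction n with
  | zero => simp [Gl]
  | succ n ih =>
    have : Gl g (n+1) = Gl g n ++ (g n).toList := rfl
    rw [this, List.mem_append, ih, Option.mem_toList]
    constructor
    · rintro (⟨k, hk, h⟩ | h)
      · exact ⟨k, by omega, h⟩
      · exact ⟨n, by omega, h⟩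
    · rintro ⟨k, hk, h⟩
      rcases Nat.lt_succ_iff_lt_or_eq.1 hk with h' | rfl
      · exact Or.inl ⟨k, h', h⟩
      · exact Or.inr h

lemma computable_Gl {g : ℕ → Option (List Bool)} (hg : Computable g) : Computable (Gl g) := by
  refine Computable.nat_rec (f := fun n : ℕ => n) (g := fun _ => ([] : List (List Bool)))
    (h := fun _ p => p.2 ++ (g p.1).toList) Computable.id (Computable.const _) ?_
  exact (Primrec.list_append.to_comp).comp (Computable.snd.comp Computable.snd)
    (Primrec.optionToList.to_comp.comp (hg.comp (Computable.fst.comp Computable.snd)))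

lemma isOpen_at (w : List Bool) (k : ℤ) :
    IsOpen {x : ℤ → Bool | ∀ i : ℕ, ∀ h : i < w.length, x (k + (i : ℤ)) = w[i]} := by
  have : {x : ℤ → Bool | ∀ i : ℕ, ∀ h : i < w.length, x (k + (i : ℤ)) = w[i]} =
      ⋂ i : Fin w.length, (fun x : ℤ → Bool => x (k + (i : ℕ))) ⁻¹' {w[i]} := by
    ext x
    simp only [Set.mem_ofPred_eq, Set.mem_iInter, Set.mem_preimage, Set.mem_singleton_iff]
    exact ⟨fun h i => h i i.2, fun h i hi => h ⟨i, hi⟩⟩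
  rw [this]
  exact isOpen_iInter_of_finite fun i => (isOpen_discrete _).preimage (continuous_apply _)

lemma isClosed_XF (F : Set (List Bool)) : IsClosed (XF F) := by
  have : XF F = ⋂ w ∈ F, ⋂ k : ℤ,
      {x : ℤ → Bool | ∀ i : ℕ, ∀ h : i < w.length, x (k + (i : ℤ)) = w[i]}ᶜ := by
    ext x
    simp only [XF, Appears, Set.mem_ofPred_eq, Set.mem_iInter, Set.mem_compl_iff, not_exists]
  rw [this]
  exact isClosed_iInter fun w => isClosed_iInter fun _ => isClosed_iInter fun k =>
    (isOpen_at w k).isClosed_compl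

lemma appears_shiftZ (w : List Bool) (x : ℤ → Bool) (n : ℤ) (h : Appears w (shiftZ n x)) :
    Appears w x := by
  obtain ⟨k, hk⟩ := h
  refine ⟨k + n, fun i hi => ?_⟩
  rw [← hk i hi]
  simp only [shiftZ]
  congr 1; ring

lemma shift_XF (F : Set (List Bool)) : shift '' (XF F) = XF F := by
  ext x
  constructor
  · rintro ⟨y, hy, rfl⟩ w hw h
    exact hy w hw (appears_shiftZ w y 1 h)
  · intro hx
    refine ⟨shiftZ (-1) x, fun w hw h => hx w hw (appears_shiftZ w x (-1) h), ?_⟩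
    funext n
    simp [shift, shiftZ]

/-- window of `x` -/
def win (x : ℤ → Bool) (a : ℤ) (n : ℕ) : List Bool := (List.range n).map fun i => x (a + (i : ℕ))

lemma win_get (x : ℤ → Bool) (a : ℤ) (n i : ℕ) (h : i < n) :
    (win x a n)[i]? = some (x (a + i)) := by
  simp [win, h]

lemma appears_of_occ (x : ℤ → Bool) (a : ℤ) (n : ℕ) (v : List Bool) (h : Occ v (win x a n)) :
    Appears v x := by
  obtain ⟨i, -, hi⟩ := h
  refine ⟨a + i, fun j hj => ?_⟩
  have h1 := hi j hj
  rw [List.getElem?_eq_getElem hj] at h1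
  have h2 : i + j < n := by
    have := (List.getElem?_eq_some_iff.1 h1).1
    simpa [win] using this
  rw [win_get _ _ _ _ h2] at h1
  have := Option.some.inj h1
  rw [← this]; push_cast; congr 1; ring

lemma appears_of_unav {F : Set (List Bool)} {w : List Bool} {n : ℕ} {vs : List (List Bool)}
    (hvs : ∀ v ∈ vs, v ∈ F) (h : Unav n (w :: vs)) (x : ℤ → Bool) (hx : x ∈ XF F) :
    Appears w x := by
  obtain ⟨v, hv, ho⟩ := h (win x 0 n) ((mem_allw _ _).2 (by simp [win]))
  have := appears_of_occ _ _ _ _ ho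
  rcases List.mem_cons.1 hv with rfl | hv
  · exact this
  · exact absurd this (hx v (hvs v hv))

lemma unav_of_empty {g : ℕ → Option (List Bool)} {w : List Bool}
    (he : XF (insert w {v | ∃ n, g n = some v}) = ∅) : ∃ n, Unav (2*n) (w :: Gl g n) := by
  by_contra hcon
  push Not at hcon
  let K : ℕ → Set (ℤ → Bool) := fun n => {x | ∀ v ∈ w :: Gl g n, ∀ k : ℤ, -(n:ℤ) ≤ k →
    k + v.length ≤ n → x ∈ {x : ℤ → Bool | ∀ i : ℕ, ∀ h : i < v.length, x (k + (i : ℤ)) = v[i]}ᶜ}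
  have hcl : ∀ n, IsClosed (K n) := by
    intro n
    have : K n = ⋂ v ∈ w :: Gl g n, ⋂ k : ℤ, ⋂ _ : -(n:ℤ) ≤ k, ⋂ _ : k + v.length ≤ n,
        {x : ℤ → Bool | ∀ i : ℕ, ∀ h : i < v.length, x (k + (i : ℤ)) = v[i]}ᶜ := by
      ext x
      simp only [K, Set.mem_iInter]
      rfl
    rw [this]
    exact isClosed_iInter fun v => isClosed_iInter fun _ => isClosed_iInter fun k =>
      isClosed_iInter fun _ => isClosed_iInter fun _ => (isOpen_at v k).isClosed_compl
  have hne : ∀ n, (K n).Nonempty := by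
    intro n
    have := hcon n
    simp only [Unav] at this
    push Not at this
    obtain ⟨u, hu, hno⟩ := this
    have hul := (mem_allw _ _).1 hu
    refine ⟨fun z => u.getD (z + n).toNat false, ?_⟩
    intro v hv k hk1 hk2 hin
    refine hno v hv ⟨(k+n).toNat, by omega, fun j hj => ?_⟩
    have h1 := hin j hj
    have h2 : (k + (j:ℤ) + n).toNat = (k+n).toNat + j := by omega
    simp only [h2] at h1
    have h3 : (k+n).toNat + j < u.length := by omega
    rw [List.getD_eq_getElem _ _ h3] at h1
    rw [List.getElem?_eq_getElem h3, List.getElem?_eq_getElem hj, h1]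
  have hmono : ∀ n, K (n+1) ⊆ K n := by
    intro n x hx v hv k h1 h2
    refine hx v ?_ k (by push_cast; omega) (by push_cast; omega)
    rcases List.mem_cons.1 hv with rfl | hv
    · simp
    · obtain ⟨m, hm, h⟩ := (mem_Gl _ _ _).1 hv
      exact List.mem_cons_of_mem _ ((mem_Gl _ _ _).2 ⟨m, by omega, h⟩)
  obtain ⟨x, hx⟩ := IsCompact.nonempty_iInter_of_sequence_nonempty_isCompact_isClosed K hmono hne
    (hcl 0).isCompact hcl
  rw [Set.mem_iInter] at hx
  have : x ∈ XF (insert w {v | ∃ n, g n = some v}) := by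
    intro v hv ⟨k, hk⟩
    have : ∃ m, ∀ n, m ≤ n → v ∈ w :: Gl g n := by
      rcases hv with rfl | ⟨m, hm⟩
      · exact ⟨0, by simp⟩
      · exact ⟨m+1, fun n hn => List.mem_cons_of_mem _ ((mem_Gl _ _ _).2 ⟨m, by omega, hm⟩)⟩
    obtain ⟨m, hm⟩ := this
    exact hx (m + k.natAbs + v.length) v (hm _ (by omega)) k (by omega)
      (by omega) hk
  rw [he] at this
  exact this

/-- extension search -/
noncomputable def tryExt (g : ℕ → Option (List Bool)) (w : List Bool) (k : ℕ) :
    Option (List Bool) :=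
  (Encodable.decode (α := Bool × Bool × ℕ) k).bind fun p =>
    bif @decide (Unav (2 * p.2.2) ((p.1 :: (w ++ [p.2.1])) :: Gl g p.2.2)) (Classical.propDecidable _)
    then some (p.1 :: (w ++ [p.2.1])) else none

lemma computable_tryExt {g : ℕ → Option (List Bool)} (hg : Computable g) :
    Computable₂ (tryExt g) := by
  classical
  refine Computable.option_bind (Computable.decode.comp Computable.snd) ?_
  have hext : Computable (fun q : (List Bool × ℕ) × Bool × Bool × ℕ =>
      q.2.1 :: (q.1.1 ++ [q.2.2.1])) :=
    Computable.list_cons.comp (Computable.fst.comp Computable.snd)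
      (Computable.list_concat.comp (Computable.fst.comp Computable.fst)
        (Computable.fst.comp (Computable.snd.comp Computable.snd)))
  have hn : Computable (fun q : (List Bool × ℕ) × Bool × Bool × ℕ => q.2.2.2) :=
    Computable.snd.comp (Computable.snd.comp Computable.snd)
  refine Computable.cond ?_ (Computable.option_some.comp hext) (Computable.const none)
  have hU : Computable₂ (fun n vs => @decide (Unav n vs) (Classical.propDecidable _)) :=
    Primrec₂.to_comp (primrec_unav.decide)
  exact hU.comp ((Primrec.nat_mul.to_comp).comp (Computable.const 2) hn)
    (Computable.list_cons.comp hext ((computable_Gl hg).comp hn))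

lemma ext_get (a b : Bool) (w : List Bool) (i : ℕ) (h : i < w.length) :
    (a :: (w ++ [b])).getD (i+1) false = w.getD i false := by
  simp [List.getElem?_append, h]

lemma ofNat_int_even (m : ℕ) : Denumerable.ofNat ℤ (2*m) = (m : ℤ) := by
  rw [Denumerable.ofNat_of_decode]
  have : Encodable.encode (m : ℤ) = 2*m := rfl
  rw [← this, Encodable.encodek]

lemma ofNat_int_odd (m : ℕ) : Denumerable.ofNat ℤ (2*m+1) = -(m : ℤ) - 1 := by
  have h : (-(m:ℤ) - 1) = Int.negSucc m := by rw [Int.negSucc_eq]; ring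
  rw [h]
  rw [Denumerable.ofNat_of_decode]
  have : Encodable.encode (Int.negSucc m) = 2*m+1 := rfl
  rw [← this, Encodable.encodek]

/-- An effective minimal subshift (defined by a c.e. set of forbidden words)
contains a computable point. -/
theorem effective_minimal_has_computable_point (F : Set (List Bool))
    (hF : IsCE F) (hne : (XF F).Nonempty) (hmin : IsMinimalOn (XF F)) :
    ∃ x ∈ XF F, Computable (toSeq x) := by
  obtain ⟨g, hg, hFg⟩ := hF
  have hG : ∀ n, ∀ v ∈ Gl g n, v ∈ F := by
    intro n v hv
    obtain ⟨k, -, hk⟩ := (mem_Gl _ _ _).1 hv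
    rw [hFg]; exact ⟨k, hk⟩
  -- language words are certified
  have hcert : ∀ w, (∃ x ∈ XF F, Appears w x) → ∃ n, Unav (2*n) (w :: Gl g n) := by
    rintro w ⟨x, hx, hw⟩
    apply unav_of_empty
    rw [← hFg]
    by_contra hE
    have hE' := Set.nonempty_iff_ne_empty.2 hE
    have := hmin (XF (insert w F)) (fun y hy v hv => hy v (Set.mem_insert_of_mem _ hv))
      (isClosed_XF _) (shift_XF _) hE'
    rw [← this] at hx
    exact hx w (Set.mem_insert _ _) hw
  obtain ⟨x0, hx0⟩ := hne
  let L : List Bool → Prop := fun w => ∃ x ∈ XF F, Appears w x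
  let R : List Bool → List Bool → Prop := fun w w' => ∃ a b, w' = a :: (w ++ [b])
  have hstep : ∀ w, L w → ∃ w', w' ∈ Nat.rfindOpt (tryExt g w) ∧ L w' ∧ R w w' := by
    rintro w ⟨x, hx, k, hk⟩
    have hdom : (Nat.rfindOpt (tryExt g w)).Dom := by
      rw [Nat.rfindOpt_dom]
      have : L (x (k-1) :: (w ++ [x (k + w.length)])) := by
        refine ⟨x, hx, k-1, fun i hi => ?_⟩
        rcases i with _ | i
        · simp
        · simp only [List.getElem_cons_succ, List.getElem_append]
          have e : k - 1 + ((i+1 : ℕ):ℤ) = k + i := by push_cast; ring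
          rw [e]
          split_ifs with h
          · exact hk i h
          · simp only [List.length_cons, List.length_append, List.length_nil] at hi
            have : i = w.length := by omega
            subst this; simp
      obtain ⟨n, hn⟩ := hcert _ this
      refine ⟨Encodable.encode (x (k-1), x (k + w.length), n),
        x (k-1) :: (w ++ [x (k + w.length)]), ?_⟩
      simp [tryExt, hn]
    obtain ⟨w', hw'⟩ := Part.dom_iff_mem.1 hdom
    refine ⟨w', hw', ?_⟩
    obtain ⟨m, hm⟩ := Nat.rfindOpt_spec hw'
    simp only [tryExt, Option.mem_def, Option.bind_eq_some_iff] at hm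
    obtain ⟨p, -, hp⟩ := hm
    by_cases hU : Unav (2 * p.2.2) ((p.1 :: (w ++ [p.2.1])) :: Gl g p.2.2)
    · simp [hU] at hp
      subst hp
      exact ⟨⟨x0, hx0, appears_of_unav (hG _) hU x0 hx0⟩, _, _, rfl⟩
    · simp [hU] at hp
  let W : ℕ →. List Bool := fun n => Nat.rec (Part.some [])
    (fun _ IH => IH.bind fun w => Nat.rfindOpt (tryExt g w)) n
  have hW : Partrec W := by
    refine Partrec.nat_rec (f := fun n : ℕ => n) (g := fun _ => Part.some ([] : List Bool))
      (h := fun _ p => Nat.rfindOpt (tryExt g p.2)) Computable.id (Computable.const _).partrec ?_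
    exact (Partrec.rfindOpt (computable_tryExt hg)).comp (Computable.snd.comp Computable.snd)
  have hWd : ∀ n, ∃ w, w ∈ W n ∧ L w := by
    intro n
    induction n with
    | zero => exact ⟨[], Part.mem_some _, x0, hx0, 0, by simp⟩
    | succ n ih =>
      obtain ⟨w, hw, hL⟩ := ih
      obtain ⟨w', h1, h2, -⟩ := hstep w hL
      exact ⟨w', Part.mem_bind hw h1, h2⟩
  choose f hf hfL using hWd
  have hfc : Computable f := hW.of_eq_tot hf
  have hf0 : f 0 = [] := Part.mem_some_iff.1 (hf 0)
  have hfs : ∀ n, R (f n) (f (n+1)) := by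
    intro n
    obtain ⟨w', h1, h2, h3⟩ := hstep _ (hfL n)
    have : f (n+1) = w' := Part.mem_unique (hf (n+1)) (Part.mem_bind (hf n) h1)
    rwa [this]
  have hlen : ∀ n, (f n).length = 2*n := by
    intro n
    induction n with
    | zero => simp [hf0]
    | succ n ih =>
      obtain ⟨a, b, h⟩ := hfs n
      rw [h]; simp [ih]; ring
  let x : ℤ → Bool := fun z => (f (z.natAbs + 1)).getD (z + (z.natAbs + 1 : ℕ)).toNat false
  have hx : ∀ (z : ℤ) (k : ℕ), z.natAbs + 1 ≤ k → (f k).getD (z + k).toNat false = x z := by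
    intro z k hk
    induction k, hk using Nat.le_induction with
    | base => rfl
    | succ k hk ih =>
      obtain ⟨a, b, h⟩ := hfs k
      have e : (z + (k+1 : ℕ)).toNat = (z + k).toNat + 1 := by omega
      rw [e, h, ext_get _ _ _ _ (by rw [hlen]; omega), ih]
  refine ⟨x, ?_, ?_⟩
  · rintro v hv ⟨k, hk⟩
    obtain ⟨y, hy, m, hm⟩ := hfL (k.natAbs + v.length + 1)
    refine hy v hv ⟨m + (k + (k.natAbs + v.length + 1 : ℕ)), fun i hi => ?_⟩
    rw [← hk i hi, ← hx (k+i) (k.natAbs + v.length + 1) (by omega)]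
    have hl : (k + i + (k.natAbs + v.length + 1 : ℕ)).toNat
      < (f (k.natAbs + v.length + 1)).length := by rw [hlen]; omega
    rw [List.getD_eq_getElem _ _ hl, ← hm _ hl]
    congr 1; omega
  · have hidx : Primrec (fun n : ℕ => if n % 2 = 0 then n/2 + n + 2 else n + 1 - n/2) := by
      have hd : Primrec (fun n : ℕ => n / 2) := Primrec.nat_div.comp .id (.const 2)
      refine Primrec.ite (Primrec.eq.comp (Primrec.nat_mod.comp .id (.const 2)) (.const 0)) ?_ ?_
      · exact Primrec.nat_add.comp (Primrec.nat_add.comp hd .id) (.const 2)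
      · exact Primrec.nat_sub.comp Primrec.succ hd
    have hc : Computable (fun n : ℕ => (f (n+2)).getD
        (if n % 2 = 0 then n/2 + n + 2 else n + 1 - n/2) false) :=
      (Primrec.list_getD false).to_comp.comp
        (hfc.comp (Primrec.nat_add.comp .id (.const 2)).to_comp) hidx.to_comp
    refine hc.of_eq fun n => ?_
    simp only [toSeq]
    rcases Nat.even_or_odd' n with ⟨m, rfl | rfl⟩
    · rw [ofNat_int_even, ← hx m (2*m+2) (by omega)]
      congr 1; split_ifs <;> omega
    · rw [ofNat_int_odd, ← hx (-(m:ℤ)-1) (2*m+1+2) (by omega)]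
      congr 1; split_ifs <;> omega
end

section
/- There exists a minimal subshift X ⊆ {0,1}^ℤ and an injection z ↦ x_z from {0,1}^ℕ into X such that for all z ≠ z′, the degrees deg_T(x_z) and deg_T(x_{z′}) are Turing-incomparable and no point y ∈ X satisfies both y ≤_T x_z and y ≤_T x_{z′}. In particular, the Turing degree spectrum of X contains 2^{ℵ₀} cones with pairwise disjoint bases. -/
namespace MinSub

open Set TopologicalSpace

/-- The phase space. -/
abbrev Pt := ℤ → Bool

theorem shiftZ_shiftZ (a b : ℤ) (x : Pt) : shiftZ a (shiftZ b x) = shiftZ (a + b) x := by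
  funext n; simp only [shiftZ]; congr 1; ring

theorem shiftZ_zero (x : Pt) : shiftZ 0 x = x := by
  funext n; simp [shiftZ]

theorem continuous_shiftZ (a : ℤ) : Continuous (shiftZ a : Pt → Pt) :=
  continuous_pi fun m => continuous_apply (m + a)

/-- Shift invariance. -/
def Inv (Y : Set Pt) : Prop := ∀ n : ℤ, ∀ x ∈ Y, shiftZ n x ∈ Y

theorem Inv.shift_image {Y : Set Pt} (h : Inv Y) : shift '' Y = Y := by
  apply Subset.antisymm
  · rintro _ ⟨x, hx, rfl⟩
    exact h 1 x hx
  · intro x hx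
    refine ⟨shiftZ (-1) x, h _ x hx, ?_⟩
    funext n
    simp [shift, shiftZ]

theorem inv_of_shift_image {Y : Set Pt} (h : shift '' Y = Y) : Inv Y := by
  have h1 : ∀ x ∈ Y, shiftZ 1 x ∈ Y := fun x hx => by
    rw [← h]; exact ⟨x, hx, rfl⟩
  have h2 : ∀ x ∈ Y, shiftZ (-1) x ∈ Y := fun x hx => by
    rw [← h] at hx
    obtain ⟨w, hw, rfl⟩ := hx
    have : shiftZ (-1) (shift w) = w := by
      funext n; simp [shift, shiftZ]
    rwa [this]
  intro n x hx
  induction n with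
  | zero => rwa [shiftZ_zero]
  | succ k ih =>
    have := h1 _ ih
    rwa [shiftZ_shiftZ, add_comm] at this
  | pred k ih =>
    have := h2 _ ih
    rwa [shiftZ_shiftZ, show (-1 : ℤ) + -(k : ℤ) = -(k : ℤ) - 1 by ring] at this

/-- The orbit of `x` visits `U`. -/
def Visits (U : Set Pt) (x : Pt) : Prop := ∃ i : ℤ, shiftZ i x ∈ U

/-- Block maps: injective continuous maps intertwining the shift with its `N`-th power. -/
structure Blk (φ : Pt → Pt) (N : ℤ) : Prop where
  pos : 0 < N
  cont : Continuous φ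
  inj : Function.Injective φ
  equi : ∀ n z, φ (shiftZ n z) = shiftZ (N * n) (φ z)

/-- The subshift generated by the image of `φ`. -/
def Sat (φ : Pt → Pt) : Set Pt := {x | ∃ i z, x = shiftZ i (φ z)}

theorem Sat_inv (φ : Pt → Pt) : Inv (Sat φ) := by
  rintro n _ ⟨i, z, rfl⟩
  exact ⟨n + i, z, shiftZ_shiftZ _ _ _⟩

theorem Blk.closed {φ : Pt → Pt} {N : ℤ} (h : Blk φ N) : IsClosed (Sat φ) := by
  have : Sat φ = ⋃ i ∈ Set.Ico (0 : ℤ) N, range (fun z => shiftZ i (φ z)) := by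
    ext x
    simp only [mem_iUnion, mem_range]
    constructor
    · rintro ⟨i, z, rfl⟩
      refine ⟨i % N, ⟨Int.emod_nonneg _ h.pos.ne', Int.emod_lt_of_pos _ h.pos⟩,
        shiftZ (i / N) z, ?_⟩
      rw [h.equi, shiftZ_shiftZ, Int.emod_add_mul_ediv]
    · rintro ⟨i, -, z, rfl⟩
      exact ⟨i, z, rfl⟩
  rw [this]
  refine (Set.finite_Ico (0 : ℤ) N).isClosed_biUnion fun i _ => ?_
  exact (isCompact_range ((continuous_shiftZ i).comp h.cont)).isClosed

theorem Blk.comp {φ ψ : Pt → Pt} {N M : ℤ} (h : Blk φ N) (k : Blk ψ M) :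
    Blk (φ ∘ ψ) (N * M) where
  pos := mul_pos h.pos k.pos
  cont := h.cont.comp k.cont
  inj := h.inj.comp k.inj
  equi n z := by
    simp only [Function.comp]
    rw [k.equi, h.equi, mul_assoc]

/-- The substitution `b ↦ P₁ P₂ b`. -/
def psi (K : ℤ) (z1 z2 z : Pt) : Pt := fun n =>
  if n % (4 * K + 3) ≤ 2 * K then z1 (n % (4 * K + 3) - K)
  else if n % (4 * K + 3) ≤ 4 * K + 1 then z2 (n % (4 * K + 3) - (3 * K + 1))
  else z (n / (4 * K + 3))

theorem psi_blk (K : ℤ) (hK : 0 ≤ K) (z1 z2 : Pt) : Blk (psi K z1 z2) (4 * K + 3) where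
  pos := by omega
  cont := by
    refine continuous_pi fun n => ?_
    unfold psi
    split_ifs
    · exact continuous_const
    · exact continuous_const
    · exact continuous_apply _
  inj := by
    intro z z' h
    funext q
    have h1 := congrFun h ((4 * K + 2) + q * (4 * K + 3))
    have e1 : ((4 * K + 2) + q * (4 * K + 3)) % (4 * K + 3) = 4 * K + 2 := by
      rw [Int.add_mul_emod_self_right]
      exact Int.emod_eq_of_lt (by omega) (by omega)
    have e2 : ((4 * K + 2) + q * (4 * K + 3)) / (4 * K + 3) = q := by
      rw [Int.add_mul_ediv_right _ _ (by omega),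
        Int.ediv_eq_zero_of_lt (by omega) (by omega), zero_add]
    simp only [psi, e1, e2] at h1
    rwa [if_neg (by omega), if_neg (by omega), if_neg (by omega), if_neg (by omega)] at h1
  equi n z := by
    funext m
    simp only [psi, shiftZ]
    rw [Int.add_mul_emod_self_left, Int.add_mul_ediv_left _ _ (by omega)]

theorem exists_radius {V : Set Pt} (hV : IsOpen V) {z : Pt} (hz : z ∈ V) :
    ∃ K0 : ℤ, ∀ K ≥ K0, ∀ w : Pt, (∀ j, -K ≤ j → j ≤ K → w j = z j) → w ∈ V := by
  obtain ⟨I, u, hu, hs⟩ := isOpen_pi_iff.1 hV z hz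
  obtain ⟨B, hB⟩ := (I.image fun i => |i|).exists_le
  refine ⟨B, fun K hK w hw => hs ?_⟩
  intro a ha
  have h1 : |a| ≤ K := (hB _ (Finset.mem_image_of_mem _ ha)).trans hK
  rw [hw a (by have := abs_le.1 h1; exact this.1) (abs_le.1 h1).2]
  exact (hu a ha).2

theorem full_step {V1 V2 : Set Pt} (h1 : IsOpen V1) (h2 : IsOpen V2)
    (n1 : V1.Nonempty) (n2 : V2.Nonempty) :
    ∃ ψ M, Blk ψ M ∧ ∀ z, Visits V1 (ψ z) ∧ Visits V2 (ψ z) := by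
  obtain ⟨z1, hz1⟩ := n1
  obtain ⟨z2, hz2⟩ := n2
  obtain ⟨K1, hK1⟩ := exists_radius h1 hz1
  obtain ⟨K2, hK2⟩ := exists_radius h2 hz2
  obtain ⟨K, k0, k1, k2⟩ : ∃ K : ℤ, 0 ≤ K ∧ K1 ≤ K ∧ K2 ≤ K :=
    ⟨max 0 (max K1 K2), by simp, by simp, by simp⟩
  refine ⟨psi K z1 z2, 4 * K + 3, psi_blk K k0 z1 z2, fun z => ⟨⟨K, ?_⟩, ⟨3 * K + 1, ?_⟩⟩⟩
  · refine hK1 K k1 _ fun j hj1 hj2 => ?_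
    simp only [shiftZ, psi]
    rw [Int.emod_eq_of_lt (by omega) (by omega), if_pos (by omega)]
    congr 1; ring
  · refine hK2 K k2 _ fun j hj1 hj2 => ?_
    simp only [shiftZ, psi]
    rw [Int.emod_eq_of_lt (by omega) (by omega), if_neg (by omega), if_pos (by omega)]
    congr 1; ring

/-- The class of subshifts used as forcing conditions. -/
def Cls (X : Set Pt) : Prop := ∃ φ N, Blk φ N ∧ X = Sat φ

theorem Cls.closed {X : Set Pt} (h : Cls X) : IsClosed X := by
  obtain ⟨φ, N, hb, rfl⟩ := h; exact hb.closed

theorem Cls.inv {X : Set Pt} (h : Cls X) : Inv X := by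
  obtain ⟨φ, N, hb, rfl⟩ := h; exact Sat_inv φ

theorem Cls.nonempty {X : Set Pt} (h : Cls X) : X.Nonempty := by
  obtain ⟨φ, N, hb, rfl⟩ := h
  exact ⟨shiftZ 0 (φ fun _ => false), 0, _, rfl⟩

theorem Sat_comp_subset (φ ψ : Pt → Pt) : Sat (φ ∘ ψ) ⊆ Sat φ := by
  rintro _ ⟨i, z, rfl⟩
  exact ⟨i, ψ z, rfl⟩

theorem cls_univ : Cls (univ : Set Pt) := by
  refine ⟨id, 1, ⟨one_pos, continuous_id, Function.injective_id, fun n z => by simp⟩, ?_⟩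
  symm
  rw [eq_univ_iff_forall]
  exact fun x => ⟨0, x, (shiftZ_zero x).symm⟩

theorem Cls.step {X : Set Pt} (h : Cls X) {U1 U2 : Set Pt} (h1 : IsOpen U1) (h2 : IsOpen U2)
    (n1 : (X ∩ U1).Nonempty) (n2 : (X ∩ U2).Nonempty) :
    ∃ X' ⊆ X, Cls X' ∧ ∀ x ∈ X', Visits U1 x ∧ Visits U2 x := by
  obtain ⟨φ, N, hb, rfl⟩ := h
  obtain ⟨_, ⟨i1, z1, rfl⟩, hu1⟩ := n1
  obtain ⟨_, ⟨i2, z2, rfl⟩, hu2⟩ := n2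
  obtain ⟨ψ, M, hψ, hv⟩ := full_step
    (h1.preimage ((continuous_shiftZ i1).comp hb.cont))
    (h2.preimage ((continuous_shiftZ i2).comp hb.cont)) ⟨z1, hu1⟩ ⟨z2, hu2⟩
  refine ⟨Sat (φ ∘ ψ), Sat_comp_subset φ ψ, ⟨_, _, hb.comp hψ, rfl⟩, ?_⟩
  rintro _ ⟨j, z, rfl⟩
  obtain ⟨⟨a, ha⟩, ⟨b, hb'⟩⟩ := hv z
  simp only [mem_preimage, Function.comp, hb.equi, shiftZ_shiftZ] at ha hb'
  refine ⟨⟨i1 + N * a - j, ?_⟩, ⟨i2 + N * b - j, ?_⟩⟩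
  · simpa [shiftZ_shiftZ] using ha
  · simpa [shiftZ_shiftZ] using hb'

theorem Cls.avoid {X : Set Pt} (h : Cls X) (y : Pt) : ∃ X' ⊆ X, Cls X' ∧ y ∉ X' := by
  obtain ⟨φ, N, hb, rfl⟩ := h
  have ho : ∀ b : Bool, IsOpen {z : Pt | z 0 = b} := fun b =>
    (isOpen_discrete ({b} : Set Bool)).preimage
      (continuous_apply (0 : ℤ) : Continuous fun z : Pt => z 0)
  obtain ⟨ψ, M, hψ, hv⟩ := full_step (ho true) (ho false) ⟨fun _ => true, rfl⟩ ⟨fun _ => false, rfl⟩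
  by_cases hy : y ∈ Sat (φ ∘ ψ)
  swap
  · exact ⟨_, Sat_comp_subset φ ψ, ⟨_, _, hb.comp hψ, rfl⟩, hy⟩
  set c : Pt := fun _ => false with hc
  have hcX : φ c ∈ Sat φ := ⟨0, c, (shiftZ_zero _).symm⟩
  have hcn : φ c ∉ Sat (φ ∘ ψ) := by
    rintro ⟨i, z, hi⟩
    have e1 : φ c = shiftZ N (φ c) := by
      have := hb.equi 1 c
      rw [mul_one] at this
      rw [← this]; rfl
    have e2 : φ (ψ z) = shiftZ (-i) (φ c) := by
      rw [hi, shiftZ_shiftZ]; simp [shiftZ_zero]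
    have e3 : φ (shiftZ 1 (ψ z)) = φ (ψ z) := by
      rw [hb.equi, mul_one, e2]
      conv_rhs => rw [e1]
      rw [shiftZ_shiftZ, shiftZ_shiftZ, add_comm]
    have e4 : ∀ n, ψ z (n + 1) = ψ z n := fun n => congrFun (hb.inj e3) n
    have e5 : ∀ n : ℤ, ψ z n = ψ z 0 := by
      intro n
      induction n with
      | zero => rfl
      | succ k ih => rw [e4, ih]
      | pred k ih => rw [← ih, ← e4 (-(k : ℤ) - 1)]; simp
    obtain ⟨⟨a, ha⟩, ⟨b, hb'⟩⟩ := hv z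
    simp only [mem_ofPred_eq, shiftZ] at ha hb'
    rw [e5] at ha hb'
    rw [ha] at hb'
    exact absurd hb' (by decide)
  have hopen : IsOpen (Sat (φ ∘ ψ))ᶜ := (hb.comp hψ).closed.isOpen_compl
  obtain ⟨X', hX', hC, hV⟩ := Cls.step ⟨φ, N, hb, rfl⟩ hopen hopen ⟨_, hcX, hcn⟩ ⟨_, hcX, hcn⟩
  refine ⟨X', hX', hC, fun hyX => ?_⟩
  obtain ⟨⟨i, hi⟩, -⟩ := hV y hyX
  exact hi (Sat_inv _ i y hy)

/-! ### Functionals -/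

/-- The functional `f` run on `x` outputs `b` at `n` . -/
def Ev (f : List Bool → ℕ → Option Bool) (x : Pt) (n : ℕ) (b : Bool) : Prop :=
  ∃ k, f (oPrefix (toSeq x) k) n = some b

theorem oPrefix_mono (s : ℕ → Bool) {k k' : ℕ} (h : k ≤ k') : oPrefix s k <+: oPrefix s k' := by
  obtain ⟨d, rfl⟩ := Nat.exists_eq_add_of_le h
  unfold oPrefix
  rw [List.range_add, List.map_append]
  exact List.prefix_append _ _

theorem Ev.unique {f : List Bool → ℕ → Option Bool} (hf : Monot f) {x : Pt} {n : ℕ} {b b' : Bool}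
    (h : Ev f x n b) (h' : Ev f x n b') : b = b' := by
  obtain ⟨k, hk⟩ := h
  obtain ⟨k', hk'⟩ := h'
  have e1 := hf _ _ _ _ (oPrefix_mono (toSeq x) (le_max_left k k')) hk
  have e2 := hf _ _ _ _ (oPrefix_mono (toSeq x) (le_max_right k k')) hk'
  rw [e1] at e2
  exact Option.some.inj e2

theorem clopen_initial (k : ℕ) (S : Set (List Bool)) :
    IsClopen {x : Pt | oPrefix (toSeq x) k ∈ S} := by
  have e : ∀ s : ℕ → Bool, oPrefix s k = List.ofFn (fun i : Fin k => s i) := by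
    intro s
    apply List.ext_getElem
    · simp [oPrefix]
    · intro i h1 h2
      simp [oPrefix]
  have hc : Continuous (fun x : Pt => fun i : Fin k => toSeq x i) :=
    continuous_pi fun i => continuous_apply _
  have h := (isClopen_discrete {v : Fin k → Bool | List.ofFn v ∈ S}).preimage hc
  convert h using 1
  ext x
  simp [e]

/-- Every evaluation is witnessed on a clopen set. -/
theorem Ev.clopen {f : List Bool → ℕ → Option Bool} {x : Pt} {n : ℕ} {b : Bool} (h : Ev f x n b) :
    ∃ W : Set Pt, IsClopen W ∧ x ∈ W ∧ ∀ w ∈ W, Ev f w n b := by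
  obtain ⟨k, hk⟩ := h
  exact ⟨{w | oPrefix (toSeq w) k ∈ {l | f l n = some b}}, clopen_initial k _, hk,
    fun w hw => ⟨k, hw⟩⟩

/-- The type of Turing functionals. -/
abbrev Fnl := {f : List Bool → ℕ → Option Bool // IsFunctional f}

theorem countable_computable :
    Countable {f : List Bool × ℕ → Option Bool // Computable f} := by
  have key : ∀ f : {f : List Bool × ℕ → Option Bool // Computable f},
      ∃ c : Nat.Partrec.Code, ∀ a, c.eval (Encodable.encode a) =
        Part.some (Encodable.encode (f.1 a)) := by
    rintro ⟨f, hf⟩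
    obtain ⟨c, hc⟩ := Nat.Partrec.Code.exists_code.1 hf
    refine ⟨c, fun a => ?_⟩
    rw [hc]
    simp
  choose c hc using key
  refine Function.Injective.countable (f := c) ?_
  intro f g h
  apply Subtype.ext
  funext a
  have := hc f a
  rw [h, hc g a] at this
  exact (Encodable.encode_injective (Part.some_injective this)).symm

instance : Countable Fnl := by
  have := countable_computable
  refine Function.Injective.countable
    (f := fun f : Fnl => (⟨fun p => f.1 p.1 p.2, f.2.1⟩ :
      {f : List Bool × ℕ → Option Bool // Computable f})) ?_
  intro f g h
  apply Subtype.ext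
  funext a b
  exact congrFun (congrArg Subtype.val h) (a, b)

theorem isFunctional_id : IsFunctional (fun l n => l[n]?) := by
  refine ⟨Computable.list_getElem?, ?_⟩
  rintro l l' n b ⟨t, rfl⟩ h
  have hn : n < l.length := (List.getElem?_eq_some_iff.1 h).1
  exact (List.getElem?_append_left hn).trans h

instance : Nonempty Fnl := ⟨⟨_, isFunctional_id⟩⟩

theorem turingLE_refl (x : ℕ → Bool) : TuringLE x x := by
  refine ⟨_, isFunctional_id, fun n => ⟨n + 1, ?_⟩⟩
  simp [oPrefix]

/-- `f` run on `x` is total with output `y`. -/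
def Out (f : Fnl) (x y : Pt) : Prop := ∀ n, Ev f.1 x n (toSeq y n)

theorem toSeq_injective : Function.Injective toSeq := by
  intro x y h
  funext m
  have := congrFun h (Encodable.encode m)
  simp only [toSeq] at this
  rwa [Denumerable.ofNat_encode] at this

theorem turingLE_iff {x y : Pt} : TuringLE (toSeq y) (toSeq x) ↔ ∃ f : Fnl, Out f x y := by
  constructor
  · rintro ⟨f, hf, h⟩
    exact ⟨⟨f, hf⟩, h⟩
  · rintro ⟨⟨f, hf⟩, h⟩
    exact ⟨f, hf, h⟩

/-! ### The minimal subshift -/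

/-- Requirement for minimality. -/
def RMin (U : Set Pt) (Y : Set Pt) : Prop := (Y ∩ U).Nonempty → ∀ y ∈ Y, Visits U y

/-- `f` takes two conflicting values on `Y ∩ U`. -/
def Dis (f : Fnl) (U Y : Set Pt) : Prop :=
  ∃ n b b', b ≠ b' ∧ ∃ x1 ∈ Y ∩ U, ∃ x2 ∈ Y ∩ U, Ev f.1 x1 n b ∧ Ev f.1 x2 n b'

/-- Requirement for functionals. -/
def RFun (f : Fnl) (U : Set Pt) (Y : Set Pt) : Prop :=
  ∀ x ∈ Y ∩ U, ∀ y ∈ Y, Out f x y → Dis f U Y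

theorem force_min {X : Set Pt} (h : Cls X) {U : Set Pt} (hU : IsOpen U) :
    ∃ X' ⊆ X, Cls X' ∧ ∀ Y ⊆ X', RMin U Y := by
  by_cases hn : (X ∩ U).Nonempty
  · obtain ⟨X', hX', hC, hv⟩ := h.step hU hU hn hn
    exact ⟨X', hX', hC, fun Y hY _ y hy => (hv y (hY hy)).1⟩
  · exact ⟨X, Subset.rfl, h, fun Y hY hYU => absurd (hYU.mono (inter_subset_inter_left _ hY)) hn⟩

theorem force_fun {X : Set Pt} (h : Cls X) {U : Set Pt} (hU : IsOpen U) (f : Fnl) :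
    ∃ X' ⊆ X, Cls X' ∧ ∀ Y ⊆ X', Inv Y → RFun f U Y := by
  by_cases hd : Dis f U X
  · obtain ⟨n, b, b', hbb, x1, ⟨hx1, hu1⟩, x2, ⟨hx2, hu2⟩, e1, e2⟩ := hd
    obtain ⟨W1, hW1, m1, c1⟩ := e1.clopen
    obtain ⟨W2, hW2, m2, c2⟩ := e2.clopen
    obtain ⟨X', hX', hC, hv⟩ := h.step (hU.inter hW1.isOpen) (hU.inter hW2.isOpen)
      ⟨x1, hx1, hu1, m1⟩ ⟨x2, hx2, hu2, m2⟩
    refine ⟨X', hX', hC, fun Y hY hinv x hx y hy _ => ?_⟩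
    obtain ⟨⟨i, hi⟩, ⟨j, hj⟩⟩ := hv x (hY hx.1)
    exact ⟨n, b, b', hbb, _, ⟨hinv i x hx.1, hi.1⟩, _, ⟨hinv j x hx.1, hj.1⟩,
      c1 _ hi.2, c2 _ hj.2⟩
  · by_cases he : ∃ x ∈ X ∩ U, ∃ y ∈ X, Out f x y
    · obtain ⟨x0, hx0, y0, hy0, ho0⟩ := he
      obtain ⟨X', hX', hC, hn⟩ := h.avoid y0
      refine ⟨X', hX', hC, fun Y hY _ x hx y hy ho => ?_⟩
      exfalso
      have : y = y0 := by
        apply toSeq_injective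
        funext n
        by_contra hne
        exact hd ⟨n, _, _, hne, x, ⟨hX' (hY hx.1), hx.2⟩, x0, hx0, ho n, ho0 n⟩
      exact hn (this ▸ hY hy)
    · refine ⟨X, Subset.rfl, h, fun Y hY _ x hx y hy ho => ?_⟩
      exact absurd ⟨x, ⟨hY hx.1, hx.2⟩, y, hY hy, ho⟩ he

theorem exists_minimal : ∃ X : Set Pt, X.Nonempty ∧ IsClosed X ∧ Inv X ∧
    (∀ U, IsOpen U → RMin U X) ∧ ∀ f U, IsOpen U → RFun f U X := by
  let B := countableBasis Pt
  have hB : IsTopologicalBasis B := isBasis_countableBasis Pt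
  have : Countable B := (countable_countableBasis Pt).to_subtype
  have : Nonempty B := by
    obtain ⟨V, hV, -⟩ := hB.exists_subset_of_mem_open (mem_univ fun _ => false) isOpen_univ
    exact ⟨⟨V, hV⟩⟩
  obtain ⟨q, hq⟩ := exists_surjective_nat (B × Fnl)
  have hstep : ∀ (k : ℕ) (X : {X : Set Pt // Cls X}), ∃ X' : {X : Set Pt // Cls X},
      X'.1 ⊆ X.1 ∧ ∀ Y ⊆ X'.1, Inv Y → RMin (q k).1.1 Y ∧ RFun (q k).2 (q k).1.1 Y := by
    rintro k ⟨X, hX⟩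
    have ho : IsOpen (q k).1.1 := hB.isOpen (q k).1.2
    obtain ⟨X1, s1, c1, r1⟩ := force_min hX ho
    obtain ⟨X2, s2, c2, r2⟩ := force_fun c1 ho (q k).2
    exact ⟨⟨X2, c2⟩, s2.trans s1, fun Y hY hi => ⟨r1 Y (hY.trans s2), r2 Y hY hi⟩⟩
  choose F hF1 hF2 using hstep
  let S : ℕ → {X : Set Pt // Cls X} := fun k => Nat.rec ⟨univ, cls_univ⟩ F k
  have hS : ∀ k, S (k + 1) = F k (S k) := fun k => rfl
  let X : Set Pt := ⋂ k, (S k).1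
  have hinv : Inv X := by
    intro n x hx
    rw [mem_iInter] at hx ⊢
    exact fun k => (S k).2.inv n x (hx k)
  have hreq : ∀ k, RMin (q k).1.1 X ∧ RFun (q k).2 (q k).1.1 X := fun k =>
    hF2 k (S k) X (by rw [← hS]; exact iInter_subset _ (k + 1)) hinv
  have hne : X.Nonempty := by
    refine IsCompact.nonempty_iInter_of_sequence_nonempty_isCompact_isClosed _
      (fun k => ?_) (fun k => (S k).2.nonempty) (S 0).2.closed.isCompact (fun k => (S k).2.closed)
    rw [hS]; exact hF1 k _
  refine ⟨X, hne, isClosed_iInter fun k => (S k).2.closed, hinv, ?_, ?_⟩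
  · rintro U hU ⟨x, hx, hxU⟩ y hy
    obtain ⟨V, hV, hxV, hVU⟩ := hB.exists_subset_of_mem_open hxU hU
    obtain ⟨k, hk⟩ := hq (⟨V, hV⟩, Classical.arbitrary _)
    have h := (hreq k).1
    rw [hk] at h
    obtain ⟨i, hi⟩ := h ⟨x, hx, hxV⟩ y hy
    exact ⟨i, hVU hi⟩
  · rintro f U hU x ⟨hx, hxU⟩ y hy ho
    obtain ⟨V, hV, hxV, hVU⟩ := hB.exists_subset_of_mem_open hxU hU
    obtain ⟨k, hk⟩ := hq (⟨V, hV⟩, f)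
    have h := (hreq k).2
    rw [hk] at h
    obtain ⟨n, b, b', hbb, x1, h1, x2, h2, e1, e2⟩ := h x ⟨hx, hxV⟩ y hy ho
    exact ⟨n, b, b', hbb, x1, ⟨h1.1, hVU h1.2⟩, x2, ⟨h2.1, hVU h2.2⟩, e1, e2⟩

/-! ### The perfect family -/

/-- Clopen sets meeting `X`. -/
abbrev Cl (X : Set Pt) := {U : Set Pt // IsClopen U ∧ (X ∩ U).Nonempty}

/-- The pair `f, g` never produces a common point of `X` from `U`, `V`. -/
def Good (X : Set Pt) (p : Fnl × Fnl) (U V : Set Pt) : Prop :=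
  ∀ x ∈ X ∩ U, ∀ x' ∈ X ∩ V, ∀ y ∈ X, Out p.1 x y → Out p.2 x' y → False

theorem Good.mono {X : Set Pt} {p : Fnl × Fnl} {U V U' V' : Set Pt} (h : Good X p U V)
    (hU : U' ⊆ U) (hV : V' ⊆ V) : Good X p U' V' :=
  fun x hx x' hx' => h x ⟨hx.1, hU hx.2⟩ x' ⟨hx'.1, hV hx'.2⟩

theorem refine_pair {X : Set Pt} (hX : ∀ f U, IsOpen U → RFun f U X) (p : Fnl × Fnl) (U V : Cl X) :
    ∃ U' V' : Cl X, U'.1 ⊆ U.1 ∧ V'.1 ⊆ V.1 ∧ Good X p U'.1 V'.1 := by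
  obtain ⟨f, g⟩ := p
  by_cases he : ∃ x ∈ X ∩ U.1, ∃ y ∈ X, Out f x y
  swap
  · exact ⟨U, V, Subset.rfl, Subset.rfl, fun x hx x' _ y hy h _ => he ⟨x, hx, y, hy, h⟩⟩
  obtain ⟨x, hx, y, hy, ho⟩ := he
  obtain ⟨n, b, b', hbb, x1, h1, x2, h2, e1, e2⟩ := hX f U.1 U.2.1.isOpen x hx y hy ho
  by_cases hg : ∃ x' ∈ X ∩ V.1, ∃ c, Ev g.1 x' n c
  swap
  · exact ⟨U, V, Subset.rfl, Subset.rfl, fun x _ x' hx' y _ _ h => hg ⟨x', hx', _, h n⟩⟩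
  obtain ⟨x', hx', c, ec⟩ := hg
  obtain ⟨d, hdc, x3, h3, e3⟩ : ∃ d, d ≠ c ∧ ∃ x3 ∈ X ∩ U.1, Ev f.1 x3 n d := by
    by_cases hb : b = c
    · exact ⟨b', fun h => hbb (hb.trans h.symm), x2, h2, e2⟩
    · exact ⟨b, hb, x1, h1, e1⟩
  obtain ⟨W1, hW1, m1, c1⟩ := e3.clopen
  obtain ⟨W2, hW2, m2, c2⟩ := ec.clopen
  refine ⟨⟨U.1 ∩ W1, U.2.1.inter hW1, ⟨x3, h3.1, h3.2, m1⟩⟩,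
    ⟨V.1 ∩ W2, V.2.1.inter hW2, ⟨x', hx'.1, hx'.2, m2⟩⟩, inter_subset_left, inter_subset_left, ?_⟩
  intro w hw w' hw' v _ o1 o2
  exact hdc (((c1 w hw.2.2).unique f.2.2 (o1 n)).trans ((o2 n).unique g.2.2 (c2 w' hw'.2.2)))

theorem refine_finite {X : Set Pt} (hX : ∀ f U, IsOpen U → RFun f U X) (p : Fnl × Fnl)
    {ι : Type} [Finite ι] (A : ι → Cl X) :
    ∃ A' : ι → Cl X, (∀ i, (A' i).1 ⊆ (A i).1) ∧ ∀ i j, i ≠ j → Good X p (A' i).1 (A' j).1 := by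
  classical
  have := Fintype.ofFinite ι
  suffices h : ∀ s : Finset (ι × ι), ∃ A' : ι → Cl X, (∀ i, (A' i).1 ⊆ (A i).1) ∧
      ∀ t ∈ s, t.1 ≠ t.2 → Good X p (A' t.1).1 (A' t.2).1 by
    obtain ⟨A', h1, h2⟩ := h Finset.univ
    exact ⟨A', h1, fun i j => h2 (i, j) (Finset.mem_univ _)⟩
  intro s
  induction s using Finset.induction_on with
  | empty => exact ⟨A, fun _ => Subset.rfl, fun t ht => absurd ht (Finset.notMem_empty t)⟩
  | insert t s _ ih =>
    obtain ⟨A1, h1, h2⟩ := ih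
    by_cases ht : t.1 = t.2
    · refine ⟨A1, h1, fun r hr hne => ?_⟩
      rcases Finset.mem_insert.1 hr with rfl | hr
      · exact absurd ht hne
      · exact h2 r hr hne
    obtain ⟨U, V, hU, hV, hg⟩ := refine_pair hX p (A1 t.1) (A1 t.2)
    let A2 : ι → Cl X := Function.update (Function.update A1 t.1 U) t.2 V
    have hA2 : ∀ i, (A2 i).1 ⊆ (A1 i).1 := by
      intro i
      by_cases h2 : i = t.2
      · subst h2; simpa [A2] using hV
      · by_cases h1 : i = t.1
        · subst h1; simpa [A2, h2] using hU
        · simp [A2, h1, h2]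
    refine ⟨A2, fun i => (hA2 i).trans (h1 i), fun r hr hne => ?_⟩
    rcases Finset.mem_insert.1 hr with rfl | hr
    · simpa [A2, ht] using hg
    · exact (h2 r hr hne).mono (hA2 _) (hA2 _)

theorem exists_family {X : Set Pt} (hne : X.Nonempty) (hcl : IsClosed X)
    (hX : ∀ f U, IsOpen U → RFun f U X) :
    ∃ e : (ℕ → Bool) → Pt, (∀ z, e z ∈ X) ∧ ∀ z z', z ≠ z' → ∀ f g : Fnl, ∀ y ∈ X,
      Out f (e z) y → Out g (e z') y → False := by
  obtain ⟨q, hq⟩ := exists_surjective_nat (Fnl × Fnl)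
  have hstep : ∀ (k : ℕ) (A : (Fin k → Bool) → Cl X), ∃ A' : (Fin (k + 1) → Bool) → Cl X,
      (∀ s, (A' s).1 ⊆ (A (fun i => s i.castSucc)).1) ∧
      ∀ s t, s ≠ t → Good X (q k.unpair.1) (A' s).1 (A' t).1 := fun k A =>
    refine_finite hX (q k.unpair.1) (fun s : Fin (k + 1) → Bool => A (fun i => s i.castSucc))
  choose F hF1 hF2 using hstep
  let A : ∀ k : ℕ, (Fin k → Bool) → Cl X := fun k =>
    Nat.rec (motive := fun k => (Fin k → Bool) → Cl X)
      (fun _ => ⟨univ, isClopen_univ, by simpa using hne⟩) F k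
  have hA : ∀ k, A (k + 1) = F k (A k) := fun k => rfl
  have hpt : ∀ z : ℕ → Bool, ∃ x ∈ X, ∀ k, x ∈ (A k (fun i => z i)).1 := by
    intro z
    have := IsCompact.nonempty_iInter_of_sequence_nonempty_isCompact_isClosed
      (fun k => X ∩ (A k (fun i => z i)).1)
      (fun k => by
        refine inter_subset_inter_right _ ?_
        rw [hA]
        exact hF1 k (A k) (fun i => z i))
      (fun k => (A k _).2.2)
      (hcl.inter (A 0 (fun i => z i)).2.1.isClosed).isCompact
      (fun k => hcl.inter (A k _).2.1.isClosed)
    obtain ⟨x, hx⟩ := this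
    rw [mem_iInter] at hx
    exact ⟨x, (hx 0).1, fun k => (hx k).2⟩
  choose e he1 he2 using hpt
  refine ⟨e, he1, fun z z' hz f g y hy h1 h2 => ?_⟩
  obtain ⟨d, hd⟩ := Function.ne_iff.1 hz
  obtain ⟨p, hp⟩ := hq (f, g)
  have hne' : (fun i : Fin (Nat.pair p d + 1) => z i) ≠ (fun i : Fin (Nat.pair p d + 1) => z' i) := by
    intro h
    exact hd (congrFun h ⟨d, Nat.lt_succ_of_le (Nat.right_le_pair p d)⟩)
  have hg := hF2 (Nat.pair p d) (A _) _ _ hne'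
  rw [← hA, Nat.unpair_pair, hp] at hg
  exact hg (e z) ⟨he1 z, he2 z (Nat.pair p d + 1)⟩ (e z')
    ⟨he1 z', he2 z' (Nat.pair p d + 1)⟩ y hy h1 h2

end MinSub

/-- Main theorem: there is a minimal subshift of `{0,1}^ℤ` together with a
continuum-sized family of points with pairwise Turing-incomparable degrees
such that no point of the subshift lies below two distinct members of the
family; hence its spectrum contains `2^ℵ₀` cones with pairwise disjoint bases. -/
theorem minimal_subshift_with_continuum_many_cones :
    ∃ (X : Set (ℤ → Bool)) (e : (ℕ → Bool) → (ℤ → Bool)),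
      X.Nonempty ∧ IsClosed X ∧ shift '' X = X ∧ IsMinimalOn X ∧
      Function.Injective e ∧ (∀ z, e z ∈ X) ∧
      ∀ z z' : ℕ → Bool, z ≠ z' →
        (¬ TuringLE (toSeq (e z)) (toSeq (e z')) ∧
         ¬ TuringLE (toSeq (e z')) (toSeq (e z))) ∧
        ∀ y ∈ X, ¬ (TuringLE (toSeq y) (toSeq (e z)) ∧
                    TuringLE (toSeq y) (toSeq (e z'))) := by
  obtain ⟨X, hne, hcl, hinv, hmin, hfun⟩ := MinSub.exists_minimal
  obtain ⟨e, he, hgood⟩ := MinSub.exists_family hne hcl hfun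
  have hno : ∀ z z' : ℕ → Bool, z ≠ z' → ∀ y ∈ X,
      ¬ (TuringLE (toSeq y) (toSeq (e z)) ∧ TuringLE (toSeq y) (toSeq (e z'))) := by
    rintro z z' hz y hy ⟨h1, h2⟩
    obtain ⟨f, hf⟩ := MinSub.turingLE_iff.1 h1
    obtain ⟨g, hg⟩ := MinSub.turingLE_iff.1 h2
    exact hgood z z' hz f g y hy hf hg
  refine ⟨X, e, hne, hcl, hinv.shift_image, ?_, ?_, he, ?_⟩
  · intro Y hYX hYc hYs ⟨y, hy⟩
    refine Set.Subset.antisymm hYX fun x hx => ?_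
    by_contra hxY
    obtain ⟨i, hi⟩ := hmin Yᶜ hYc.isOpen_compl ⟨x, hx, hxY⟩ y (hYX hy)
    exact hi (MinSub.inv_of_shift_image hYs i y hy)
  · intro z z' h
    by_contra hz
    refine hno z z' hz (e z) (he z) ⟨MinSub.turingLE_refl _, ?_⟩
    rw [← h]
    exact MinSub.turingLE_refl _
  · intro z z' hz
    exact ⟨⟨fun h => hno z z' hz (e z) (he z) ⟨MinSub.turingLE_refl _, h⟩,
      fun h => hno z z' hz (e z') (he z') ⟨h, MinSub.turingLE_refl _⟩⟩, hno z z' hz⟩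
end
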